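/- arXiv:2203.09363 — 2 statements merged into one kernel-verified Lean document; each statement's English description precedes it below -/
import Mathlib

section
/- Fix integers m, N ≥ 1 and let a* ∈ ℝ^{N+1} satisfy Q(a*) = a*. For any integer α, define d1, ã ∈ ℝ^{N+1} by (d1)_n = (−1)^{mn}·a*_n and ã = (−1)^α·d1, set d2 = 0 ∈ ℝ^{N+1} and Y = απ. Then the point (d1, ã, d2, Y) is a zero of the map G : ℝ^{3(N+1)+1} → ℝ^{3(N+1)+1} defined by G(d1, ã, d2, Y) = (d1 − cos(Y)·ã, Q(d1) − cos(Y)·ã, d2 − sin(Y)·ã, −sin(Y)). -/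
/-- The quadratic matching map `Q : ℝ^{N+1} → ℝ^{N+1}`,
`Q_n(a) = 2·∑_{j=1}^{N−n} cos(mπ(n−j)/3)·a_j·a_{n+j}
        + ∑_{j=0}^{n} cos(mπ(n−2j)/3)·a_j·a_{n−j}`. -/
noncomputable def Qmap (m N : ℕ) (a : ℕ → ℝ) (n : ℕ) : ℝ :=
  2 * ∑ j ∈ Finset.Icc 1 (N - n),
      Real.cos ((m : ℝ) * Real.pi * ((n : ℝ) - (j : ℝ)) / 3) * a j * a (n + j)
  + ∑ j ∈ Finset.range (n + 1),
      Real.cos ((m : ℝ) * Real.pi * ((n : ℝ) - 2 * (j : ℝ)) / 3) * a j * a (n - j)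

theorem Qmap_sign (m N : ℕ) (a : ℕ → ℝ) (n : ℕ) :
    Qmap m N (fun n => (-1 : ℝ) ^ (m * n) * a n) n = (-1 : ℝ) ^ (m * n) * Qmap m N a n := by
  unfold Qmap
  rw [mul_add, mul_left_comm ((-1 : ℝ) ^ (m * n))]
  congr 1
  · congr 1
    rw [Finset.mul_sum]
    refine Finset.sum_congr rfl fun j _ => ?_
    have h : (-1 : ℝ) ^ (m * j) * (-1 : ℝ) ^ (m * (n + j)) = (-1 : ℝ) ^ (m * n) := by
      rw [← pow_add, show m * j + m * (n + j) = m * n + 2 * (m * j) by ring, pow_add, pow_mul]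
      simp
    rw [← h]; ring
  · rw [Finset.mul_sum]
    refine Finset.sum_congr rfl fun j hj => ?_
    have hj' : j ≤ n := Nat.lt_succ_iff.mp (Finset.mem_range.mp hj)
    have h : (-1 : ℝ) ^ (m * j) * (-1 : ℝ) ^ (m * (n - j)) = (-1 : ℝ) ^ (m * n) := by
      rw [← pow_add, ← mul_add, Nat.add_sub_cancel' hj']
    rw [← h]; ring

/-- if `a*` is a fixed point of `Q` and `α ∈ ℤ`, then the point
`(d1, ã, d2, Y)` with `(d1)_n = (−1)^{mn} a*_n`, `ã = (−1)^α d1`, `d2 = 0`, `Y = απ`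
is a zero of the matching function
`G(d1, ã, d2, Y) = (d1 − cos(Y)·ã, Q(d1) − cos(Y)·ã, d2 − sin(Y)·ã, −sin(Y))`. -/
theorem Gmap_zero (m N : ℕ) (hm : 1 ≤ m) (hN : 1 ≤ N)
    (a : ℕ → ℝ) (ha : ∀ n ≤ N, Qmap m N a n = a n) (α : ℤ) :
    let d1 : ℕ → ℝ := fun n => (-1 : ℝ) ^ (m * n) * a n
    let atil : ℕ → ℝ := fun n => (-1 : ℝ) ^ α * d1 n
    let d2 : ℕ → ℝ := fun _ => 0
    let Y : ℝ := (α : ℝ) * Real.pi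
    (∀ n ≤ N, d1 n - Real.cos Y * atil n = 0) ∧
    (∀ n ≤ N, Qmap m N d1 n - Real.cos Y * atil n = 0) ∧
    (∀ n ≤ N, d2 n - Real.sin Y * atil n = 0) ∧
    -Real.sin Y = 0 := by
  intro d1 atil d2 Y
  have hs : Real.sin Y = 0 := Real.sin_int_mul_pi α
  have hc : Real.cos Y = (-1 : ℝ) ^ α := Real.cos_int_mul_pi α
  have h1 : ∀ n, Real.cos Y * atil n = d1 n := by
    intro n
    have h2 : (-1 : ℝ) ^ α * (-1 : ℝ) ^ α = 1 := by
      rw [← mul_zpow]; simp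
    simp only [atil]
    rw [hc, ← mul_assoc, h2, one_mul]
  refine ⟨fun n _ => by rw [h1, sub_self], fun n hn => ?_, fun n _ => by simp [d2, hs], by simp [hs]⟩
  rw [h1, Qmap_sign, ha n hn, sub_self]
end

section
/- There exists a continuous function α : [0,1] → ℝ with α(t) > 0 for all t ∈ [0,1] that satisfies the nonlocal integral equation α(t) = 2·∫_0^{1−t} α(s)·α(s+t) ds + ∫_0^t α(s)·α(t−s) ds for every t ∈ [0,1]. -/
open MeasureTheory Set Filter Topology

structure NLGood (f : ℝ → ℝ) : Prop where
  nonneg : ∀ x, 0 ≤ f x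
  le_one : ∀ x, f x ≤ 1
  anti : ∀ x y, |x| ≤ |y| → f y ≤ f x
  supp : ∀ x, 1 < |x| → f x = 0

structure NLV (a : ℝ → ℝ) : Prop where
  meas : Measurable a
  bdd : ∃ B, ∀ x, |a x| ≤ B
  even : ∀ x, a (-x) = a x
  supp : ∀ x, 1 < |x| → a x = 0

theorem NLGood.even {f : ℝ → ℝ} (hf : NLGood f) (x : ℝ) : f (-x) = f x :=
  le_antisymm (hf.anti _ _ (by simp)) (hf.anti _ _ (by simp))

theorem NLGood.abs {f : ℝ → ℝ} (hf : NLGood f) (x : ℝ) : f |x| = f x :=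
  le_antisymm (hf.anti _ _ (by simp)) (hf.anti _ _ (by simp))

theorem NLGood.countable {f : ℝ → ℝ} (hf : NLGood f) :
    {x | ¬ ContinuousAt f x}.Countable := by
  set g : ℝ → ℝ := fun x => f (max x 0) with hg
  have hga : Antitone g := by
    intro x y hxy
    apply hf.anti
    rw [abs_of_nonneg (le_max_right _ _), abs_of_nonneg (le_max_right _ _)]
    exact max_le_max_right 0 hxy
  have hD := hga.countable_not_continuousAt
  have hD' : ((fun x : ℝ => -x) ⁻¹' {x | ¬ ContinuousAt g x}).Countable :=
    hD.preimage neg_injective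
  refine ((hD.union hD').union (countable_singleton (0:ℝ))).mono ?_
  intro x hx
  by_contra hcon
  simp only [mem_union, mem_ofPred_eq, mem_preimage, mem_singleton_iff, not_or, not_not] at hcon
  obtain ⟨⟨h1, h2⟩, h3⟩ := hcon
  apply hx
  rcases lt_or_gt_of_ne h3 with h | h
  · have : f =ᶠ[𝓝 x] (fun y => g (-y)) := by
      filter_upwards [gt_mem_nhds h] with y hy
      simp only [hg]
      rw [max_eq_left (by linarith), hf.even]
    refine ContinuousAt.congr ?_ this.symm
    exact ContinuousAt.comp (f := fun y : ℝ => -y) (g := g) h2 continuous_neg.continuousAt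
  · have : f =ᶠ[𝓝 x] g := by
      filter_upwards [lt_mem_nhds h] with y hy
      simp only [hg]
      rw [max_eq_left (by linarith)]
    exact h1.congr this.symm

theorem NLGood.ae_cont {f : ℝ → ℝ} (hf : NLGood f) : ∀ᵐ x, ContinuousAt f x := by
  have := hf.countable.ae_notMem volume
  filter_upwards [this] with x hx
  simpa using hx

theorem NLGood.toV {f : ℝ → ℝ} (hf : NLGood f) : NLV f where
  meas := measurable_of_countable_not_continuousAt hf.countable
  bdd := ⟨1, fun x => by rw [abs_of_nonneg (hf.nonneg x)]; exact hf.le_one x⟩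
  even := hf.even
  supp := hf.supp

theorem nl_int1 {h : ℝ → ℝ} (hm : Measurable h) (hb : ∃ B, ∀ x, |h x| ≤ B)
    (hs : ∀ x, 1 < |x| → h x = 0) : Integrable h := by
  obtain ⟨B, hB⟩ := hb
  have h1 : Function.support h ⊆ Icc (-1) 1 := by
    intro x hx
    rw [mem_Icc, ← abs_le]
    by_contra hc
    exact hx (hs x (not_le.mp hc))
  rw [← integrableOn_iff_integrable_of_support_subset h1]
  exact Measure.integrableOn_of_bounded (M := B) (by simp) hm.aestronglyMeasurable
    (Eventually.of_forall hB)

theorem nl_int2 {h : ℝ × ℝ → ℝ} (hm : Measurable h) (hb : ∃ B, ∀ x, |h x| ≤ B)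
    (hs : ∀ x y, 1 < |x| ∨ 1 < |y| → h (x, y) = 0) : Integrable h := by
  obtain ⟨B, hB⟩ := hb
  have h1 : Function.support h ⊆ Icc (-1) 1 ×ˢ Icc (-1) 1 := by
    rintro ⟨x, y⟩ hx
    rw [mem_prod, mem_Icc, ← abs_le, mem_Icc, ← abs_le]
    by_contra hc
    rw [not_and_or, not_le, not_le] at hc
    exact hx (hs x y hc)
  rw [← integrableOn_iff_integrable_of_support_subset h1]
  refine Measure.integrableOn_of_bounded (M := B) ?_ hm.aestronglyMeasurable
    (Eventually.of_forall hB)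
  rw [Measure.volume_eq_prod, Measure.prod_prod]
  simp [ENNReal.mul_eq_top]

noncomputable def nlconv (f : ℝ → ℝ) (t : ℝ) : ℝ := ∫ s, f s * f (t - s)

noncomputable def nltri (a b c : ℝ → ℝ) : ℝ := ∫ p : ℝ × ℝ, a p.1 * b p.2 * c (p.1 - p.2)

theorem NLV.int_conv {a b : ℝ → ℝ} (ha : NLV a) (hb : NLV b) (t : ℝ) :
    Integrable (fun s => a s * b (t - s)) := by
  obtain ⟨A, hA⟩ := ha.bdd
  obtain ⟨B, hB⟩ := hb.bdd
  refine nl_int1 (ha.meas.mul (hb.meas.comp (measurable_const.sub measurable_id)))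
    ⟨A * B, fun x => ?_⟩ (fun x hx => by rw [ha.supp x hx, zero_mul])
  rw [abs_mul]
  exact mul_le_mul (hA _) (hB _) (abs_nonneg _) ((abs_nonneg _).trans (hA 0))

theorem NLV.int_mul {a b : ℝ → ℝ} (ha : NLV a) (hb : NLV b) :
    Integrable (fun s => a s * b s) := by
  have := ha.int_conv hb 0
  simpa [hb.even] using this

theorem NLV.int_tri {a b c : ℝ → ℝ} (ha : NLV a) (hb : NLV b) (hc : NLV c) :
    Integrable (fun p : ℝ × ℝ => a p.1 * b p.2 * c (p.1 - p.2)) := by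
  obtain ⟨A, hA⟩ := ha.bdd
  obtain ⟨B, hB⟩ := hb.bdd
  obtain ⟨C, hC⟩ := hc.bdd
  have hA0 := (abs_nonneg _).trans (hA 0)
  have hB0 := (abs_nonneg _).trans (hB 0)
  refine nl_int2 (((ha.meas.comp measurable_fst).mul (hb.meas.comp measurable_snd)).mul
    (hc.meas.comp (measurable_fst.sub measurable_snd))) ⟨A * B * C, fun x => ?_⟩ ?_
  · rw [abs_mul, abs_mul]
    exact mul_le_mul (mul_le_mul (hA _) (hB _) (abs_nonneg _) hA0) (hC _) (abs_nonneg _)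
      (mul_nonneg hA0 hB0)
  · rintro x y (h | h)
    · simp [ha.supp x h]
    · simp [hb.supp y h]

theorem NLV.tri_swap {a b c : ℝ → ℝ} (hc : NLV c) :
    nltri a b c = nltri b a c := by
  unfold nltri
  rw [Measure.volume_eq_prod, ← integral_prod_swap]
  congr 1
  ext p
  simp only [Prod.fst_swap, Prod.snd_swap]
  rw [← hc.even (p.1 - p.2), neg_sub]
  ring

theorem NLV.tri_eq {a b c : ℝ → ℝ} (ha : NLV a) (hb : NLV b) (hc : NLV c) :
    nltri a b c = ∫ t, a t * ∫ s, b s * c (t - s) := by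
  unfold nltri
  have := ha.int_tri hb hc
  rw [Measure.volume_eq_prod] at this ⊢
  rw [integral_prod _ this]
  congr 1
  ext t
  rw [← integral_const_mul]
  congr 1
  ext s
  ring

theorem NLV.tri_swap2 {a b c : ℝ → ℝ} (ha : NLV a) (hb : NLV b) (hc : NLV c) :
    nltri a b c = nltri a c b := by
  rw [ha.tri_eq hb hc, ha.tri_eq hc hb]
  congr 1
  ext t
  rw [← integral_sub_left_eq_self _ volume t]
  congr 2
  ext s
  rw [sub_sub_cancel]
  ring

theorem NLV.tri_expand {f g : ℝ → ℝ} (hf : NLV f) (hg : NLV g) (e : ℝ) :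
    nltri (fun x => f x + e * g x) (fun x => f x + e * g x) (fun x => f x + e * g x) =
      nltri f f f + 3 * e * nltri g f f + 3 * e ^ 2 * nltri g g f + e ^ 3 * nltri g g g := by
  have h1 : nltri f g f = nltri g f f := hf.tri_swap
  have h2 : nltri f f g = nltri g f f := by rw [hf.tri_swap2 hf hg, h1]
  have h3 : nltri g f g = nltri g g f := hg.tri_swap2 hf hg
  have h4 : nltri f g g = nltri g g f := by rw [hg.tri_swap, h3]
  have key : nltri (fun x => f x + e * g x) (fun x => f x + e * g x) (fun x => f x + e * g x) =
      nltri f f f + e * nltri g f f + e * nltri f g f + e * nltri f f g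
      + e ^ 2 * nltri g g f + e ^ 2 * nltri g f g + e ^ 2 * nltri f g g
      + e ^ 3 * nltri g g g := by
    unfold nltri
    have i1 := hf.int_tri hf hf
    have i2 := (hg.int_tri hf hf).const_mul e
    have i3 := (hf.int_tri hg hf).const_mul e
    have i4 := (hf.int_tri hf hg).const_mul e
    have i5 := (hg.int_tri hg hf).const_mul (e ^ 2)
    have i6 := (hg.int_tri hf hg).const_mul (e ^ 2)
    have i7 := (hf.int_tri hg hg).const_mul (e ^ 2)
    have i8 := (hg.int_tri hg hg).const_mul (e ^ 3)
    simp only [← integral_const_mul]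
    rw [← integral_add' i1 i2, ← integral_add' (i1.add i2) i3,
      ← integral_add' ((i1.add i2).add i3) i4, ← integral_add' (((i1.add i2).add i3).add i4) i5,
      ← integral_add' ((((i1.add i2).add i3).add i4).add i5) i6,
      ← integral_add' (((((i1.add i2).add i3).add i4).add i5).add i6) i7,
      ← integral_add' ((((((i1.add i2).add i3).add i4).add i5).add i6).add i7) i8]
    congr 1
    ext p
    simp only [Pi.add_apply]
    ring
  rw [key, h1, h2, h3, h4]
  ring

theorem NLV.sq_expand {f g : ℝ → ℝ} (hf : NLV f) (hg : NLV g) (e : ℝ) :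
    ∫ x, (f x + e * g x) * (f x + e * g x) =
      (∫ x, f x * f x) + 2 * e * (∫ x, g x * f x) + e ^ 2 * ∫ x, g x * g x := by
  have i1 := hf.int_mul hf
  have i2 := (hg.int_mul hf).const_mul (2 * e)
  have i3 := (hg.int_mul hg).const_mul (e ^ 2)
  rw [← integral_const_mul, ← integral_const_mul, ← integral_add' i1 i2,
    ← integral_add' (i1.add i2) i3]
  congr 1
  ext p
  simp only [Pi.add_apply]
  ring

theorem NLGood.conv_zero {f : ℝ → ℝ} (hf : NLGood f) : nlconv f 0 = ∫ x, f x * f x := by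
  unfold nlconv
  simp [hf.even]

theorem NLGood.conv_nonneg {f : ℝ → ℝ} (hf : NLGood f) (t : ℝ) : 0 ≤ nlconv f t :=
  integral_nonneg fun _ => mul_nonneg (hf.nonneg _) (hf.nonneg _)

theorem NLGood.conv_even {f : ℝ → ℝ} (hf : NLGood f) (t : ℝ) : nlconv f (-t) = nlconv f t := by
  unfold nlconv
  rw [← integral_neg_eq_self]
  congr 1
  ext s
  rw [hf.even, ← hf.even (-t - -s)]
  congr 2
  ring

theorem NLGood.conv_anti_aux {f : ℝ → ℝ} (hf : NLGood f) {t u : ℝ} (ht : 0 ≤ t) (htu : t ≤ u) :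
    nlconv f u ≤ nlconv f t := by
  have hV := hf.toV
  have i1 := hV.int_conv hV t
  have i2 := hV.int_conv hV u
  have e1 : nlconv f t - nlconv f u = ∫ s, f s * (f (t - s) - f (u - s)) := by
    unfold nlconv
    rw [← integral_sub i1 i2]
    congr 1
    ext s
    ring
  have i3 : Integrable (fun s => f s * (f (t - s) - f (u - s))) := by
    refine (i1.sub i2).congr (Eventually.of_forall fun s => ?_)
    simp only [Pi.sub_apply]
    ring
  have e2 : nlconv f t - nlconv f u = ∫ s, f (t + u - s) * (f (u - s) - f (t - s)) := by
    rw [e1, ← integral_sub_left_eq_self _ volume (t + u)]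
    congr 1
    ext s
    rw [← hf.even (t - (t + u - s)), ← hf.even (u - (t + u - s))]
    ring_nf
  have i4 : Integrable (fun s => f (t + u - s) * (f (u - s) - f (t - s))) := by
    refine (i3.comp_sub_left (t + u)).congr (Eventually.of_forall fun s => ?_)
    simp only
    rw [← hf.even (t - (t + u - s)), ← hf.even (u - (t + u - s))]
    ring_nf
  have e3 : 2 * (nlconv f t - nlconv f u) =
      ∫ s, (f s - f (t + u - s)) * (f (t - s) - f (u - s)) := by
    rw [two_mul]
    nth_rewrite 1 [e1]
    rw [e2, ← integral_add i3 i4]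
    congr 1
    ext s
    ring
  have : 0 ≤ 2 * (nlconv f t - nlconv f u) := by
    rw [e3]
    refine integral_nonneg fun s => ?_
    simp only [Pi.zero_apply]
    rcases le_total (2 * s) (t + u) with h | h
    · apply mul_nonneg
      · refine sub_nonneg.mpr (hf.anti _ _ ?_)
        rw [abs_le, abs_of_nonneg (by linarith : 0 ≤ t + u - s)]
        constructor <;> linarith
      · refine sub_nonneg.mpr (hf.anti _ _ ?_)
        rw [abs_le, abs_of_nonneg (by linarith : 0 ≤ u - s)]
        constructor <;> linarith
    · apply mul_nonneg_of_nonpos_of_nonpos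
      · refine sub_nonpos.mpr (hf.anti _ _ ?_)
        rw [abs_le, abs_of_nonneg (by linarith : 0 ≤ s)]
        constructor <;> linarith
      · refine sub_nonpos.mpr (hf.anti _ _ ?_)
        rw [abs_le, abs_of_nonpos (by linarith : t - s ≤ 0)]
        constructor <;> linarith
  linarith

theorem NLGood.conv_anti {f : ℝ → ℝ} (hf : NLGood f) {t u : ℝ} (htu : |t| ≤ |u|) :
    nlconv f u ≤ nlconv f t := by
  have habs : ∀ x, nlconv f |x| = nlconv f x := by
    intro x
    rcases abs_choice x with h | h <;> rw [h]
    exact hf.conv_even x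
  rw [← habs t, ← habs u]
  exact hf.conv_anti_aux (abs_nonneg _) htu

theorem NLGood.conv_cont {f : ℝ → ℝ} (hf : NLGood f) : Continuous (nlconv f) := by
  rw [continuous_iff_continuousAt]
  intro t
  have hV := hf.toV
  refine continuousAt_of_dominated (bound := f) ?_ ?_ ?_ ?_
  · exact Eventually.of_forall fun x => (hV.int_conv hV x).aestronglyMeasurable
  · refine Eventually.of_forall fun x => Eventually.of_forall fun s => ?_
    rw [Real.norm_of_nonneg (mul_nonneg (hf.nonneg _) (hf.nonneg _))]
    exact mul_le_of_le_one_right (hf.nonneg _) (hf.le_one _)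
  · exact nl_int1 hV.meas hV.bdd hV.supp
  · have := (quasiMeasurePreserving_sub_left_of_right_invariant volume t).ae hf.ae_cont
    filter_upwards [this] with s hs
    refine continuousAt_const.mul ?_
    exact ContinuousAt.comp (f := fun x : ℝ => x - s) (g := f) hs
      (continuous_id.sub continuous_const).continuousAt

theorem nl_compact (F : ℕ → ℝ → ℝ) (hF : ∀ n, NLGood (F n)) :
    ∃ f, NLGood f ∧ ∃ φ : ℕ → ℕ, StrictMono φ ∧
      ∀ᵐ x, Tendsto (fun n => F (φ n) x) atTop (𝓝 (f x)) := by
  have hK : IsCompact (Set.pi univ (fun _ : ℚ => Icc (0:ℝ) 1)) :=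
    isCompact_univ_pi fun _ => isCompact_Icc
  obtain ⟨ψ, -, φ, hφ, hlim⟩ := hK.tendsto_subseq (x := fun n (q : ℚ) => F n q)
    (fun n q _ => ⟨(hF n).nonneg _, (hF n).le_one _⟩)
  rw [tendsto_pi_nhds] at hlim
  let U : Ultrafilter ℕ := Ultrafilter.of atTop
  have hU : (U : Filter ℕ) ≤ atTop := Ultrafilter.of_le atTop
  have hex : ∀ x : ℝ, ∃ y, Tendsto (fun n => F (φ n) x) U (𝓝 y) := by
    intro x
    have hmem : (U.map (fun n => F (φ n) x) : Filter ℝ) ≤ 𝓟 (Icc (0:ℝ) 1) := by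
      rw [le_principal_iff]
      exact Filter.mem_map.mpr (univ_mem' fun n => ⟨(hF _).nonneg _, (hF _).le_one _⟩)
    obtain ⟨y, -, hy⟩ := isCompact_Icc.ultrafilter_le_nhds _ hmem
    exact ⟨y, hy⟩
  choose f hf using hex
  have hgood : NLGood f := by
    refine ⟨fun x => ?_, fun x => ?_, fun x y hxy => ?_, fun x hx => ?_⟩
    · exact ge_of_tendsto' (hf x) fun n => (hF _).nonneg _
    · exact le_of_tendsto' (hf x) fun n => (hF _).le_one _
    · exact le_of_tendsto_of_tendsto' (hf y) (hf x) fun n => (hF _).anti _ _ hxy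
    · refine tendsto_nhds_unique (hf x) ?_
      simp only [(hF _).supp x hx]
      exact tendsto_const_nhds
  have hq : ∀ q : ℚ, Tendsto (fun n => F (φ n) q) atTop (𝓝 (f q)) := by
    intro q
    have h1 := hlim q
    simp only [Function.comp_apply] at h1
    have : f q = ψ q := tendsto_nhds_unique (hf q) (h1.mono_left hU)
    rw [this]
    exact h1
  have hpos : ∀ x, 0 < x → ContinuousAt f x → Tendsto (fun n => F (φ n) x) atTop (𝓝 (f x)) := by
    intro x hx hc
    rw [tendsto_order]
    constructor
    · intro a ha
      have h1 : ∀ᶠ y in 𝓝 x, a < f y := hc.eventually (lt_mem_nhds ha)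
      obtain ⟨d, hd, hd'⟩ := Metric.eventually_nhds_iff.mp h1
      obtain ⟨r, hr1, hr2⟩ := exists_rat_btwn (show x < x + d by linarith)
      have h2 : a < f r := hd' (by rw [Real.dist_eq, abs_lt]; constructor <;> linarith)
      filter_upwards [(hq r).eventually (lt_mem_nhds h2)] with n hn
      refine hn.trans_le ((hF _).anti _ _ ?_)
      rw [abs_of_pos hx]
      exact hr1.le.trans (le_abs_self _)
    · intro a ha
      have h1 : ∀ᶠ y in 𝓝 x, f y < a := hc.eventually (gt_mem_nhds ha)
      obtain ⟨d, hd, hd'⟩ := Metric.eventually_nhds_iff.mp h1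
      obtain ⟨r, hr1, hr2⟩ := exists_rat_btwn (show max 0 (x - d) < x from max_lt hx (by linarith))
      have hr0 := (le_max_left _ _).trans_lt hr1
      have hr3 := (le_max_right _ _).trans_lt hr1
      have h2 : f r < a := hd' (by rw [Real.dist_eq, abs_lt]; constructor <;> linarith)
      filter_upwards [(hq r).eventually (gt_mem_nhds h2)] with n hn
      refine ((hF _).anti _ _ ?_).trans_lt hn
      rw [abs_of_pos hx, abs_of_pos hr0]
      exact hr2.le
  refine ⟨f, hgood, φ, hφ, ?_⟩
  have h0 : ∀ᵐ x : ℝ, x ≠ 0 := by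
    simpa using (countable_singleton (0:ℝ)).ae_notMem volume
  filter_upwards [hgood.ae_cont, h0] with x hx hx0
  rcases lt_or_gt_of_ne hx0 with h | h
  · have hc : ContinuousAt f (-x) := by
      have he : f = fun y => f (-y) := by ext y; rw [hgood.even]
      rw [he]
      refine ContinuousAt.comp (f := fun y : ℝ => -y) (g := f) ?_ continuous_neg.continuousAt
      simpa using hx
    have := hpos (-x) (by linarith) hc
    simpa only [(hF _).even, hgood.even] using this
  · exact hpos x h hx

noncomputable def nlchi : ℝ → ℝ := (Icc (-1:ℝ) 1).indicator 1

theorem nlchi_eq {x : ℝ} (h : |x| ≤ 1) : nlchi x = 1 := by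
  unfold nlchi
  rw [indicator_of_mem]
  · rfl
  · exact abs_le.mp h

theorem nlchi_eq0 {x : ℝ} (h : 1 < |x|) : nlchi x = 0 := by
  unfold nlchi
  rw [indicator_of_notMem]
  intro hx
  exact absurd (abs_le.mpr hx) (not_le.mpr h)

theorem nlchi_good : NLGood nlchi := by
  have h01 : ∀ x, nlchi x = 0 ∨ nlchi x = 1 := fun x =>
    (le_or_gt |x| 1).elim (fun h => Or.inr (nlchi_eq h)) (fun h => Or.inl (nlchi_eq0 h))
  refine ⟨fun x => ?_, fun x => ?_, fun x y hxy => ?_, fun x hx => nlchi_eq0 hx⟩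
  · rcases h01 x with h | h <;> rw [h] <;> norm_num
  · rcases h01 x with h | h <;> rw [h] <;> norm_num
  · rcases le_or_gt |y| 1 with h | h
    · rw [nlchi_eq h, nlchi_eq (hxy.trans h)]
    · rw [nlchi_eq0 h]
      rcases h01 x with h | h <;> rw [h]
      norm_num

theorem NLGood.le_chi {f : ℝ → ℝ} (hf : NLGood f) (x : ℝ) : f x ≤ nlchi x := by
  rcases le_or_gt |x| 1 with h | h
  · rw [nlchi_eq h]; exact hf.le_one x
  · rw [nlchi_eq0 h, hf.supp x h]

noncomputable def nlJ (f : ℝ → ℝ) : ℝ := nltri f f f - 3 / 4 * (∫ x, f x * f x) ^ 2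

theorem nl_tri_le {f : ℝ → ℝ} (hf : NLGood f) : nltri f f f ≤ nltri nlchi nlchi nlchi := by
  have h1 := hf.toV
  have h2 := nlchi_good.toV
  refine integral_mono (h1.int_tri h1 h1) (h2.int_tri h2 h2) fun p => ?_
  have := nlchi_good.nonneg
  exact mul_le_mul (mul_le_mul (hf.le_chi _) (hf.le_chi _) (hf.nonneg _) (this _))
    (hf.le_chi _) (hf.nonneg _) (mul_nonneg (this _) (this _))

theorem nl_chi_sq : ∫ x, nlchi x * nlchi x = 2 := by
  have : (fun x => nlchi x * nlchi x) = (Icc (-1:ℝ) 1).indicator (fun _ => (1:ℝ)) := by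
    ext x
    unfold nlchi
    by_cases h : x ∈ Icc (-1:ℝ) 1 <;> simp [h]
  rw [this, integral_indicator measurableSet_Icc]
  simp
  norm_num

theorem nl_sq_le {f : ℝ → ℝ} (hf : NLGood f) : ∫ x, f x * f x ≤ 2 := by
  rw [← nl_chi_sq]
  refine integral_mono (hf.toV.int_mul hf.toV) (nlchi_good.toV.int_mul nlchi_good.toV) fun p => ?_
  exact mul_le_mul (hf.le_chi _) (hf.le_chi _) (hf.nonneg _) (nlchi_good.nonneg _)

theorem nl_tri_chi : 1 ≤ nltri nlchi nlchi nlchi := by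
  have h2 := nlchi_good.toV
  have hS : MeasurableSet (Icc (0:ℝ) 1 ×ˢ Icc (0:ℝ) 1) := measurableSet_Icc.prod measurableSet_Icc
  have e : ∫ p : ℝ × ℝ, (Icc (0:ℝ) 1 ×ˢ Icc (0:ℝ) 1).indicator (fun _ => (1:ℝ)) p = 1 := by
    rw [integral_indicator hS]
    rw [setIntegral_const, measureReal_def, Measure.volume_eq_prod, Measure.prod_prod]
    simp
  unfold nltri
  rw [← e]
  refine integral_mono_of_nonneg (Eventually.of_forall fun p => ?_) (h2.int_tri h2 h2)
    (Eventually.of_forall fun p => ?_)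
  · exact indicator_nonneg (fun _ _ => zero_le_one) _
  · have hn := nlchi_good.nonneg
    by_cases hp : p ∈ Icc (0:ℝ) 1 ×ˢ Icc (0:ℝ) 1
    · simp only [indicator_of_mem hp]
      obtain ⟨⟨h1, h2⟩, ⟨h3, h4⟩⟩ := hp
      rw [nlchi_eq, nlchi_eq, nlchi_eq] <;> first | norm_num | skip
      all_goals rw [abs_le]; constructor <;> linarith
    · simp only [indicator_of_notMem hp]
      exact mul_nonneg (mul_nonneg (hn _) (hn _)) (hn _)

theorem nl_J_pos : ∃ f, NLGood f ∧ 0 < nlJ f := by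
  refine ⟨fun x => 1 / 4 * nlchi x, ?_, ?_⟩
  · have h := nlchi_good
    refine ⟨fun x => ?_, fun x => ?_, fun x y hxy => ?_, fun x hx => ?_⟩
    · have := h.nonneg x; positivity
    · have := h.le_one x; linarith
    · have := h.anti x y hxy; linarith
    · rw [h.supp x hx]; norm_num
  · have e1 : nltri (fun x => 1 / 4 * nlchi x) (fun x => 1 / 4 * nlchi x)
        (fun x => 1 / 4 * nlchi x) = 1 / 64 * nltri nlchi nlchi nlchi := by
      unfold nltri
      rw [← integral_const_mul]
      congr 1
      ext p
      ring
    have e2 : ∫ x, (1 / 4 * nlchi x) * (1 / 4 * nlchi x) = 1 / 8 := by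
      have : (fun x => (1 / 4 * nlchi x) * (1 / 4 * nlchi x)) =
        fun x => 1 / 16 * (nlchi x * nlchi x) := by ext x; ring
      rw [this, integral_const_mul, nl_chi_sq]
      norm_num
    unfold nlJ
    rw [e1, e2]
    have := nl_tri_chi
    linarith

theorem nl_J_lim (F : ℕ → ℝ → ℝ) (hF : ∀ n, NLGood (F n)) (f : ℝ → ℝ)
    (h : ∀ᵐ x, Tendsto (fun n => F n x) atTop (𝓝 (f x))) :
    Tendsto (fun n => nlJ (F n)) atTop (𝓝 (nlJ f)) := by
  have hχ := nlchi_good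
  have hn := hχ.nonneg
  unfold nlJ
  refine Tendsto.sub ?_ (Tendsto.const_mul _ (Tendsto.pow ?_ 2))
  · unfold nltri
    refine tendsto_integral_of_dominated_convergence
      (fun p : ℝ × ℝ => nlchi p.1 * nlchi p.2) ?_ ?_ ?_ ?_
    · exact fun n => ((hF n).toV.int_tri (hF n).toV (hF n).toV).aestronglyMeasurable
    · refine nl_int2 ((hχ.toV.meas.comp measurable_fst).mul (hχ.toV.meas.comp measurable_snd))
        ⟨1, fun x => ?_⟩ ?_
      · rw [abs_of_nonneg (mul_nonneg (hn _) (hn _))]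
        exact mul_le_one₀ (hχ.le_one _) (hn _) (hχ.le_one _)
      · rintro x y (h | h) <;> simp [nlchi_eq0 h]
    · refine fun n => Eventually.of_forall fun p => ?_
      have h0 := (hF n).nonneg
      rw [Real.norm_of_nonneg (mul_nonneg (mul_nonneg (h0 _) (h0 _)) (h0 _))]
      refine (mul_le_of_le_one_right (mul_nonneg (h0 _) (h0 _)) ((hF n).le_one _)).trans ?_
      exact mul_le_mul ((hF n).le_chi _) ((hF n).le_chi _) (h0 _) (hn _)
    · rw [Measure.volume_eq_prod]
      have a1 := (Measure.quasiMeasurePreserving_fst (μ := (volume : Measure ℝ))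
        (ν := (volume : Measure ℝ))).ae h
      have a2 := (Measure.quasiMeasurePreserving_snd (μ := (volume : Measure ℝ))
        (ν := (volume : Measure ℝ))).ae h
      have a3 := (quasiMeasurePreserving_sub_of_right_invariant (volume : Measure ℝ)
        (volume : Measure ℝ)).ae h
      filter_upwards [a1, a2, a3] with p h1 h2 h3
      exact (h1.mul h2).mul h3
  · refine tendsto_integral_of_dominated_convergence nlchi ?_ ?_ ?_ ?_
    · exact fun n => ((hF n).toV.int_mul (hF n).toV).aestronglyMeasurable
    · exact nl_int1 hχ.toV.meas hχ.toV.bdd hχ.toV.supp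
    · refine fun n => Eventually.of_forall fun x => ?_
      have h0 := (hF n).nonneg
      rw [Real.norm_of_nonneg (mul_nonneg (h0 _) (h0 _))]
      exact (mul_le_of_le_one_right (h0 _) ((hF n).le_one _)).trans ((hF n).le_chi _)
    · filter_upwards [h] with x hx
      exact hx.mul hx

theorem nl_exists_max : ∃ f, NLGood f ∧ 0 < nlJ f ∧ ∀ g, NLGood g → nlJ g ≤ nlJ f := by
  obtain ⟨f₀, hf₀, hJ₀⟩ := nl_J_pos
  set S := nlJ '' {f | NLGood f} with hS
  have hne : S.Nonempty := ⟨_, f₀, hf₀, rfl⟩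
  have hb : BddAbove S := by
    refine ⟨nltri nlchi nlchi nlchi, ?_⟩
    rintro _ ⟨f, hf, rfl⟩
    have := nl_tri_le hf
    unfold nlJ
    nlinarith [sq_nonneg (∫ x, f x * f x)]
  obtain ⟨u, -, hu, huS⟩ := exists_seq_tendsto_sSup hne hb
  choose F hF hFu using huS
  obtain ⟨f, hf, φ, hφ, hlim⟩ := nl_compact F hF
  have h1 := nl_J_lim (fun n => F (φ n)) (fun n => hF _) f hlim
  have h2 : Tendsto (fun n => nlJ (F (φ n))) atTop (𝓝 (sSup S)) := by
    simp only [hFu]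
    exact hu.comp hφ.tendsto_atTop
  have h3 : nlJ f = sSup S := tendsto_nhds_unique h1 h2
  refine ⟨f, hf, ?_, fun g hg => ?_⟩
  · rw [h3]
    exact hJ₀.trans_le (le_csSup hb ⟨f₀, hf₀, rfl⟩)
  · rw [h3]
    exact le_csSup hb ⟨g, hg, rfl⟩

theorem nl_poly {Q a b c : ℝ}
    (h : ∀ e : ℝ, 0 < e → e ≤ 1 / 2 → 3 * e * Q + e ^ 2 * (a + e * b + e ^ 2 * c) ≤ 0) :
    Q ≤ 0 := by
  have h1 : Tendsto (fun e : ℝ => 3 * Q + e * (a + e * b + e ^ 2 * c)) (𝓝[>] 0)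
      (𝓝 (3 * Q + 0 * (a + 0 * b + 0 ^ 2 * c))) := by
    refine Tendsto.mono_left ?_ nhdsWithin_le_nhds
    exact Continuous.tendsto (by fun_prop) 0
  have h2 : 3 * Q + 0 * (a + 0 * b + 0 ^ 2 * c) ≤ 0 := by
    refine le_of_tendsto h1 ?_
    filter_upwards [Ioc_mem_nhdsGT (show (0:ℝ) < 1 / 2 by norm_num)] with e he
    have := h e he.1 he.2
    have h3 : e * (3 * Q + e * (a + e * b + e ^ 2 * c)) ≤ 0 := by linarith
    by_contra hc
    have := mul_pos he.1 (not_le.mp hc)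
    linarith
  linarith

noncomputable def nlT (f : ℝ → ℝ) : ℝ → ℝ := (Icc (-1:ℝ) 1).indicator (nlconv f)

theorem nlT_eq {f : ℝ → ℝ} {x : ℝ} (h : |x| ≤ 1) : nlT f x = nlconv f x :=
  indicator_of_mem (s := Icc (-1:ℝ) 1) (abs_le.mp h) _

theorem nlT_eq0 {f : ℝ → ℝ} {x : ℝ} (h : 1 < |x|) : nlT f x = 0 :=
  indicator_of_notMem (s := Icc (-1:ℝ) 1) (fun hx => absurd (abs_le.mpr hx) (not_le.mpr h)) _

theorem nl_critical {f : ℝ → ℝ} (hf : NLGood f) (hmax : ∀ g, NLGood g → nlJ g ≤ nlJ f) :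
    ∀ᵐ x, nlT f x = (∫ x, f x * f x) * f x := by
  set n := ∫ x, f x * f x with hn
  have hn0 : 0 ≤ n := integral_nonneg fun x => mul_self_nonneg _
  have hn2 : n ≤ 2 := nl_sq_le hf
  have hV := hf.toV
  have hT0 : ∀ x, 0 ≤ nlT f x := indicator_nonneg fun x _ => hf.conv_nonneg x
  have hTn : ∀ x, nlT f x ≤ n := by
    intro x
    rcases le_or_gt |x| 1 with h | h
    · rw [nlT_eq h, hn, ← hf.conv_zero]
      exact hf.conv_anti (by simp)
    · rw [nlT_eq0 h]; exact hn0
  have hTanti : ∀ x y, |x| ≤ |y| → nlT f y ≤ nlT f x := by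
    intro x y hxy
    rcases le_or_gt |y| 1 with h | h
    · rw [nlT_eq h, nlT_eq (hxy.trans h)]
      exact hf.conv_anti hxy
    · rw [nlT_eq0 h]; exact hT0 x
  set g : ℝ → ℝ := fun x => nlT f x - n * f x with hg
  have hgV : NLV g := by
    refine ⟨?_, ⟨4, fun x => ?_⟩, fun x => ?_, fun x hx => ?_⟩
    · exact (hf.conv_cont.measurable.indicator measurableSet_Icc).sub (hV.meas.const_mul n)
    · have h1 := hT0 x
      have h2 := hTn x
      have h3 := mul_nonneg hn0 (hf.nonneg x)
      have h4 := mul_le_of_le_one_right hn0 (hf.le_one x)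
      simp only [hg]
      rw [abs_le]
      constructor <;> linarith
    · simp only [hg]
      rw [hf.even, le_antisymm (hTanti (-x) x (by simp)) (hTanti x (-x) (by simp))]
    · simp only [hg]
      rw [nlT_eq0 hx, hf.supp x hx]
      ring
  have hgood : ∀ e : ℝ, 0 < e → e ≤ 1 / 2 → NLGood (fun x => f x + e * g x) := by
    intro e he he2
    have hen : 0 ≤ 1 - e * n := by nlinarith
    have hform : ∀ x, f x + e * g x = (1 - e * n) * f x + e * nlT f x := fun x => by
      simp only [hg]; ring
    simp only [hform]
    refine ⟨fun x => ?_, fun x => ?_, fun x y hxy => ?_, fun x hx => ?_⟩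
    · have := hf.nonneg x
      have := hT0 x
      positivity
    · have h1 := mul_le_of_le_one_right hen (hf.le_one x)
      have h2 := mul_le_mul_of_nonneg_left (hTn x) he.le
      linarith
    · exact add_le_add (mul_le_mul_of_nonneg_left (hf.anti x y hxy) hen)
        (mul_le_mul_of_nonneg_left (hTanti x y hxy) he.le)
    · rw [nlT_eq0 hx, hf.supp x hx]
      ring
  have hA : nltri g f f = n * (∫ x, g x * f x) + ∫ x, g x * g x := by
    rw [hgV.tri_eq hV hV, ← integral_const_mul,
      ← integral_add ((hgV.int_mul hV).const_mul n) (hgV.int_mul hgV)]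
    congr 1
    ext x
    rcases le_or_gt |x| 1 with h | h
    · have : g x = nlconv f x - n * f x := by simp only [hg]; rw [nlT_eq h]
      change g x * nlconv f x = _
      rw [this]
      ring
    · rw [hgV.supp x h]; ring
  have hQ : ∫ x, g x * g x ≤ 0 := by
    set Q := ∫ x, g x * g x with hQd
    set P := ∫ x, g x * f x with hP
    set B := nltri g g f
    set C := nltri g g g
    refine nl_poly (a := 3 * B - 3 * P ^ 2 - 3 / 2 * n * Q) (b := C - 3 * P * Q)
      (c := -(3 / 4) * Q ^ 2) fun e he he2 => ?_
    have h1 := hmax _ (hgood e he he2)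
    unfold nlJ at h1
    rw [hV.tri_expand hgV e, hV.sq_expand hgV e, hA] at h1
    nlinarith
  have hQ0 : ∫ x, g x * g x = 0 := le_antisymm hQ (integral_nonneg fun x => mul_self_nonneg _)
  rw [integral_eq_zero_iff_of_nonneg (fun x => mul_self_nonneg _) (hgV.int_mul hgV)] at hQ0
  filter_upwards [hQ0] with x hx
  have : g x = 0 := by simpa using hx
  simp only [hg] at this
  linarith

theorem nl_exists_u : ∃ u : ℝ → ℝ, Continuous u ∧ (∀ x, u (-x) = u x) ∧ (∀ x, 0 ≤ u x) ∧
    0 < u 0 ∧ ∀ t, u t = ∫ s, (Icc (-1:ℝ) 1).indicator u s * (Icc (-1:ℝ) 1).indicator u (t - s) := by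
  obtain ⟨f, hf, hJ, hmax⟩ := nl_exists_max
  have hcrit := nl_critical hf hmax
  set n := ∫ x, f x * f x with hn
  have hn0 : 0 ≤ n := integral_nonneg fun x => mul_self_nonneg _
  have hnpos : 0 < n := by
    refine lt_of_le_of_ne hn0 fun h => ?_
    have h2 : ∫ x, f x * f x = 0 := h.symm
    rw [integral_eq_zero_iff_of_nonneg (fun x => mul_self_nonneg _) (hf.toV.int_mul hf.toV)] at h2
    have h3 : nltri f f f = 0 := by
      rw [hf.toV.tri_eq hf.toV hf.toV]
      refine integral_eq_zero_of_ae ?_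
      filter_upwards [h2] with x hx
      have : f x = 0 := by simpa using hx
      simp [this]
    have : nlJ f = 0 := by
      unfold nlJ
      rw [h3, ← hn, ← h]
      norm_num
    linarith
  refine ⟨fun t => nlconv f t / n ^ 2, hf.conv_cont.div_const _, fun x => ?_, fun x => ?_, ?_, ?_⟩
  · simp only [hf.conv_even]
  · exact div_nonneg (hf.conv_nonneg x) (by positivity)
  · simp only [hf.conv_zero]
    rw [← hn]
    positivity
  · intro t
    set G : ℝ → ℝ := (Icc (-1:ℝ) 1).indicator fun t => nlconv f t / n ^ 2 with hG
    have hGf : ∀ᵐ x, G x = f x / n := by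
      filter_upwards [hcrit] with x hx
      have : G x = nlT f x / n ^ 2 := by
        simp only [hG, nlT]
        by_cases h : x ∈ Icc (-1:ℝ) 1 <;> simp [h]
      rw [this, hx]
      field_simp
    have hGf' := (quasiMeasurePreserving_sub_left_of_right_invariant volume t).ae hGf
    have : ∫ s, G s * G (t - s) = ∫ s, (f s * f (t - s)) / n ^ 2 := by
      refine integral_congr_ae ?_
      filter_upwards [hGf, hGf'] with s h1 h2
      rw [h1, h2]
      field_simp
    rw [this, integral_div]
    rfl

/-- there exists a continuous, strictly positive function `α : [0,1] → ℝ`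
solving the nonlocal integral equation
`α(t) = 2·∫_0^{1−t} α(s)·α(s+t) ds + ∫_0^t α(s)·α(t−s) ds` for every `t ∈ [0,1]`. -/
theorem exists_positive_continuous_solution :
    ∃ α : ℝ → ℝ, ContinuousOn α (Set.Icc 0 1) ∧
      (∀ t ∈ Set.Icc (0 : ℝ) 1, 0 < α t) ∧
      ∀ t ∈ Set.Icc (0 : ℝ) 1,
        α t = 2 * (∫ s in (0 : ℝ)..(1 - t), α s * α (s + t)) +
          ∫ s in (0 : ℝ)..t, α s * α (t - s) := by
  obtain ⟨u, hc, heven, hnn, hu0, heq⟩ := nl_exists_u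
  have key : ∀ t ∈ Set.Icc (0 : ℝ) 1,
        u t = 2 * (∫ s in (0 : ℝ)..(1 - t), u s * u (s + t)) +
          ∫ s in (0 : ℝ)..t, u s * u (t - s) := by
    rintro t ⟨ht0, ht1⟩
    have e1 : u t = ∫ s in (t - 1)..1, u s * u (t - s) := by
      rw [intervalIntegral.integral_of_le (by linarith), ← integral_Icc_eq_integral_Ioc,
        ← integral_indicator measurableSet_Icc, heq t]
      congr 1
      ext s
      by_cases h : s ∈ Icc (t - 1) 1
      · have h1 : s ∈ Icc (-1:ℝ) 1 := ⟨by linarith [h.1], h.2⟩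
        have h2 : t - s ∈ Icc (-1:ℝ) 1 := ⟨by linarith [h.2], by linarith [h.1]⟩
        rw [indicator_of_mem h, indicator_of_mem h1, indicator_of_mem h2]
      · rw [indicator_of_notMem h]
        by_cases h1 : s ∈ Icc (-1:ℝ) 1
        · have h2 : t - s ∉ Icc (-1:ℝ) 1 := fun h2 => h ⟨by linarith [h2.2], h1.2⟩
          rw [indicator_of_notMem h2, mul_zero]
        · rw [indicator_of_notMem h1, zero_mul]
    have hcont : Continuous fun s => u s * u (t - s) := by fun_prop
    have e2 : ∫ s in (t - 1)..0, u s * u (t - s) = ∫ s in (0 : ℝ)..(1 - t), u s * u (s + t) := by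
      have := intervalIntegral.integral_comp_neg (a := 0) (b := 1 - t) (fun s => u s * u (t - s))
      rw [neg_zero, neg_sub] at this
      rw [← this]
      congr 1
      ext s
      rw [heven]
      congr 2
      ring
    have e3 : ∫ s in t..1, u s * u (t - s) = ∫ s in (0 : ℝ)..(1 - t), u s * u (s + t) := by
      have := intervalIntegral.integral_comp_add_right (a := 0) (b := 1 - t)
        (fun s => u s * u (t - s)) t
      rw [zero_add, sub_add_cancel] at this
      rw [← this]
      congr 1
      ext s
      rw [← heven (t - (s + t))]
      ring_nf
    rw [e1, ← intervalIntegral.integral_add_adjacent_intervals (b := t)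
        (hcont.intervalIntegrable _ _) (hcont.intervalIntegrable _ _),
      ← intervalIntegral.integral_add_adjacent_intervals (a := t - 1) (b := 0)
        (hcont.intervalIntegrable _ _) (hcont.intervalIntegrable _ _), e2, e3]
    ring
  refine ⟨u, hc.continuousOn, ?_, key⟩
  intro t ht
  by_contra hneg
  have hut : u t = 0 := le_antisymm (not_lt.mp hneg) (hnn t)
  have hcomp : IsCompact (Icc (0:ℝ) 1 ∩ u ⁻¹' {0}) :=
    isCompact_Icc.inter_right (isClosed_singleton.preimage hc)
  obtain ⟨b, ⟨hb, hub⟩, hmin⟩ := hcomp.exists_isLeast ⟨t, ht, hut⟩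
  have hub' : u b = 0 := hub
  have hpos : ∀ s, 0 ≤ s → s < b → 0 < u s := by
    intro s hs hsb
    refine lt_of_le_of_ne (hnn s) fun h => ?_
    have := hmin (show s ∈ Icc (0:ℝ) 1 ∩ u ⁻¹' {0} from ⟨⟨hs, hsb.le.trans hb.2⟩, h.symm⟩)
    linarith
  have hb0 : 0 < b := by
    refine lt_of_le_of_ne hb.1 fun h => ?_
    rw [← h] at hub'
    linarith
  have hcont : Continuous fun s => u s * u (b - s) := by fun_prop
  have h1 : 0 < ∫ s in (0 : ℝ)..b, u s * u (b - s) := by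
    refine intervalIntegral.intervalIntegral_pos_of_pos_on (hcont.intervalIntegrable _ _) ?_ hb0
    rintro s ⟨hs0, hsb⟩
    exact mul_pos (hpos s hs0.le hsb) (hpos (b - s) (by linarith) (by linarith))
  have h2 : 0 ≤ ∫ s in (0 : ℝ)..(1 - b), u s * u (s + b) :=
    intervalIntegral.integral_nonneg (by linarith [hb.2]) fun s _ => mul_nonneg (hnn _) (hnn _)
  have h3 := key b hb
  linarith
end
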